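/- Let T be a tree in 𝒯₃ with n ≥ 30 vertices. Then either there is an edge e of T such that 2·α(T,e) ≥ n·ᾱ(T,e), or there is an internal vertex v of T such that 2·α(T,v) ≥ n·ᾱ(T,v). -/

import Mathlib

open SimpleGraph Finset BigOperators Filter

attribute [local instance] Classical.propDecidable

/-- A finset of vertices induces a subtree of `G`: it is nonempty and its induced
subgraph is connected. -/
def SimpleGraph.IsSubtree {V : Type*} (G : SimpleGraph V) (s : Finset V) : Prop :=
  s.Nonempty ∧ (G.induce (s : Set V)).Connected

/-- The collection of all subtrees of `G` (as finsets of vertices). -/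
noncomputable def subtreeFinset {V : Type*} [Fintype V] (G : SimpleGraph V) :
    Finset (Finset V) :=
  Finset.univ.filter G.IsSubtree

/-- `G` is in the class 𝒯₃: a tree with at least one internal vertex (a vertex of
degree at least 2) in which every internal vertex has degree at least 3. -/
noncomputable def InT3 {V : Type*} [Fintype V] (G : SimpleGraph V) : Prop :=
  G.IsTree ∧ (∃ v, 2 ≤ G.degree v) ∧ ∀ v, 2 ≤ G.degree v → 3 ≤ G.degree v

/-- `α(G,v)`: the number of subtrees of `G` containing the vertex `v`. -/
noncomputable def alphaV {V : Type*} [Fintype V] (G : SimpleGraph V) (v : V) : ℕ :=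
  ((subtreeFinset G).filter (fun s => v ∈ s)).card

/-- `ᾱ(G,v)`: the number of subtrees of `G` not containing the vertex `v`. -/
noncomputable def alphaBarV {V : Type*} [Fintype V] (G : SimpleGraph V) (v : V) : ℕ :=
  ((subtreeFinset G).filter (fun s => v ∉ s)).card

/-- `α(G,e)` for an edge `e = xy`: the number of subtrees of `G` containing both
endpoints of `e`. -/
noncomputable def alphaE {V : Type*} [Fintype V] (G : SimpleGraph V) (x y : V) : ℕ :=
  ((subtreeFinset G).filter (fun s => x ∈ s ∧ y ∈ s)).card

/-- `ᾱ(G,e)` for an edge `e = xy`: the number of subtrees of `G` not containing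
both endpoints of `e`. -/
noncomputable def alphaBarE {V : Type*} [Fintype V] (G : SimpleGraph V) (x y : V) : ℕ :=
  ((subtreeFinset G).filter (fun s => ¬ (x ∈ s ∧ y ∈ s))).card

section Counting

/-- Multiplying two families of sets living in disjoint ground sets by taking unions. -/
theorem card_mul_card_le_card_of_union {α : Type*} {X Y Z : Finset (Finset α)} {C B : Finset α}
    (hCB : Disjoint C B) (hX : ∀ s ∈ X, s ⊆ C) (hY : ∀ t ∈ Y, t ⊆ B)
    (hZ : ∀ s ∈ X, ∀ t ∈ Y, s ∪ t ∈ Z) : X.card * Y.card ≤ Z.card := by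
  rw [← Finset.card_product]
  apply Finset.card_le_card_of_injOn (fun p => p.1 ∪ p.2)
  · rintro ⟨s, t⟩ hst
    have hst := Finset.mem_product.1 (Finset.mem_coe.1 hst)
    exact hZ s hst.1 t hst.2
  · rintro ⟨s, t⟩ hst ⟨s', t'⟩ hst' h
    have hst := Finset.mem_product.1 (Finset.mem_coe.1 hst)
    have hst' := Finset.mem_product.1 (Finset.mem_coe.1 hst')
    have h1 := hX s hst.1
    have h2 := hY t hst.2
    have h3 := hX s' hst'.1
    have h4 := hY t' hst'.2
    have key : ∀ a, a ∈ C → a ∉ B := fun a ha hb => Finset.disjoint_left.1 hCB ha hb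
    have hu : ∀ a, (a ∈ s ∨ a ∈ t) ↔ (a ∈ s' ∨ a ∈ t') := fun a => by
      have := congrArg (fun q => a ∈ q) h
      simpa using this
    rw [Prod.mk.injEq]
    constructor
    · ext a
      have := hu a
      have := @h1 a
      have := @h2 a
      have := @h3 a
      have := @h4 a
      have := key a
      tauto
    · ext a
      have := hu a
      have := @h1 a
      have := @h2 a
      have := @h3 a
      have := @h4 a
      have := key a
      tauto

theorem two_pow_mul_sum_le_prod {ι : Type*} (D : Finset ι) (g : ι → ℕ) :
    2 ^ D.card * (2 + ∑ z ∈ D, g z) ≤ 2 * ∏ z ∈ D, (2 + g z) := by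
  induction D using Finset.induction_on with
  | empty => simp
  | insert a D ha ih =>
    rw [Finset.card_insert_of_notMem ha, Finset.sum_insert ha, Finset.prod_insert ha]
    have h1 : 2 ^ D.card * 2 ≤ 2 * ∏ z ∈ D, (2 + g z) :=
      le_trans (Nat.mul_le_mul_left _ (Nat.le_add_right _ _)) ih
    calc 2 ^ (D.card + 1) * (2 + (g a + ∑ z ∈ D, g z))
        = 2 * (2 ^ D.card * (2 + ∑ z ∈ D, g z)) + g a * (2 ^ D.card * 2) := by ring
      _ ≤ 2 * (2 * ∏ z ∈ D, (2 + g z)) + g a * (2 * ∏ z ∈ D, (2 + g z)) := by gcongr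
      _ = 2 * ((2 + g a) * ∏ z ∈ D, (2 + g z)) := by ring

theorem two_mul_sum_lt_prod_add_card {ι : Type*} (D : Finset ι) (f : ι → ℕ)
    (hf : ∀ z ∈ D, 1 ≤ f z) (hD : 2 ≤ D.card) :
    2 * ∑ z ∈ D, f z + 1 ≤ ∏ z ∈ D, (1 + f z) + D.card := by
  have h := two_pow_mul_sum_le_prod D (fun z => f z - 1)
  have h1 : ∏ z ∈ D, (2 + (f z - 1)) = ∏ z ∈ D, (1 + f z) :=
    Finset.prod_congr rfl fun z hz => by have := hf z hz; omega
  have h2 : ∑ z ∈ D, f z = ∑ z ∈ D, (f z - 1) + D.card := by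
    rw [Finset.card_eq_sum_ones, ← Finset.sum_add_distrib]
    exact Finset.sum_congr rfl fun z hz => by have := hf z hz; omega
  rw [h1] at h
  obtain ⟨j, hj⟩ := Nat.exists_eq_add_of_le hD
  have h3 : D.card < 2 ^ D.card := Nat.lt_two_pow_self
  have h4 : 4 ≤ 2 ^ D.card := by
    calc 4 = 2 ^ 2 := rfl
      _ ≤ 2 ^ D.card := Nat.pow_le_pow_right (by norm_num) hD
  nlinarith [Nat.mul_le_mul_right (∑ z ∈ D, (f z - 1)) h4]

theorem two_pow_le_prod_sq {ι : Type*} {D : Finset ι} {f m : ι → ℕ} {k : ℕ} (hk : k ≤ ∑ z ∈ D, m z)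
    (h : ∀ z ∈ D, 2 ^ (m z + 1) ≤ (1 + f z) ^ 2) :
    2 ^ (k + D.card) ≤ (∏ z ∈ D, (1 + f z)) ^ 2 := by
  rw [← Finset.prod_pow]
  refine le_trans ?_ (Finset.prod_le_prod' h)
  rw [Finset.prod_pow_eq_pow_sum, Finset.sum_add_distrib, ← Finset.card_eq_sum_ones]
  exact Nat.pow_le_pow_right two_pos (by omega)

theorem pow_six_le_two_pow {n : ℕ} (hn : 30 ≤ n) : n ^ 6 ≤ 2 ^ n := by
  induction n, hn using Nat.le_induction with
  | base => norm_num
  | succ n hn ih =>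
    have h1 : (30 * (n + 1)) ^ 6 ≤ (31 * n) ^ 6 := Nat.pow_le_pow_left (by omega) 6
    rw [mul_pow, mul_pow] at h1
    have h2 : 31 ^ 6 * n ^ 6 ≤ 30 ^ 6 * (2 * n ^ 6) := by
      rw [← mul_assoc]
      exact Nat.mul_le_mul_right _ (by norm_num)
    have h3 : (n + 1) ^ 6 ≤ 2 * n ^ 6 :=
      Nat.le_of_mul_le_mul_left (h1.trans h2) (by norm_num)
    calc (n + 1) ^ 6 ≤ 2 * n ^ 6 := h3
      _ ≤ 2 * 2 ^ n := Nat.mul_le_mul_left _ ih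
      _ = 2 ^ (n + 1) := (pow_succ' _ _).symm

end Counting

namespace SimpleGraph

variable {V : Type*} {G : SimpleGraph V}

theorem isSubtree_singleton (v : V) : G.IsSubtree {v} := by
  refine ⟨Finset.singleton_nonempty v, ?_⟩
  rw [Finset.coe_singleton]
  exact (connected_iff _).2 ⟨fun a b => by rw [Subsingleton.elim a b], ⟨⟨v, rfl⟩⟩⟩

theorem IsSubtree.union {s t : Finset V} {v w : V} (hs : G.IsSubtree s) (ht : G.IsSubtree t)
    (hv : v ∈ s) (hw : w ∈ t) (ha : G.Adj v w) : G.IsSubtree (s ∪ t) := by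
  refine ⟨hs.1.mono Finset.subset_union_left, ?_⟩
  rw [Finset.coe_union]
  exact connected_induce_union hs.2.preconnected ht.2.preconnected
    (Finset.mem_coe.2 hv) (Finset.mem_coe.2 hw) ha

variable [Fintype V]

/-- The vertices closer to `x` than to `y`; in a tree with an edge `xy`, the component of `x`
after deleting the edge. -/
noncomputable def branch (G : SimpleGraph V) (x y : V) : Finset V :=
  Finset.univ.filter fun u => G.dist u x < G.dist u y

/-- The subtrees of `G` contained in `C`. -/
noncomputable def subtreesIn (G : SimpleGraph V) (C : Finset V) : Finset (Finset V) :=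
  (subtreeFinset G).filter fun s => s ⊆ C

/-- The subtrees of `G` contained in `C` and containing `r`. -/
noncomputable def rootedIn (G : SimpleGraph V) (r : V) (C : Finset V) : Finset (Finset V) :=
  (subtreeFinset G).filter fun s => r ∈ s ∧ s ⊆ C

theorem mem_branch {x y u : V} : u ∈ G.branch x y ↔ G.dist u x < G.dist u y := by
  simp [branch]

theorem mem_subtreesIn {C s : Finset V} : s ∈ G.subtreesIn C ↔ G.IsSubtree s ∧ s ⊆ C := by
  simp [subtreesIn, subtreeFinset]

theorem mem_rootedIn {r : V} {C s : Finset V} :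
    s ∈ G.rootedIn r C ↔ G.IsSubtree s ∧ r ∈ s ∧ s ⊆ C := by
  simp [rootedIn, subtreeFinset]

theorem notMem_branch_right (x y : V) : y ∉ G.branch x y := by
  simp [mem_branch]

theorem Connected.exists_adj_mem_branch (hG : G.Connected) {u v : V} (h : u ≠ v) :
    ∃ z, G.Adj v z ∧ u ∈ G.branch z v := by
  obtain ⟨p, hp⟩ := hG.exists_walk_length_eq_dist v u
  cases p with
  | nil => exact absurd rfl h
  | @cons _ z _ hz q =>
    refine ⟨z, hz, mem_branch.2 ?_⟩
    have := dist_le q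
    rw [G.dist_comm (u := u), G.dist_comm (u := u)]
    simp at hp
    omega

namespace IsTree

theorem eq_of_mem_branch (hG : G.IsTree) {u v z w : V} (hz : G.Adj v z) (hw : G.Adj v w)
    (huz : u ∈ G.branch z v) (huw : u ∈ G.branch w v) : z = w := by
  rw [mem_branch] at huz huw
  have key : ∀ {x}, G.Adj v x → G.dist u x < G.dist u v →
      ∃ q : G.Walk x u, ∀ h : G.Adj v x, (Walk.cons h q).IsPath := by
    intro x hx hux
    obtain ⟨q, hq⟩ := hG.connected.exists_walk_length_eq_dist x u
    refine ⟨q, fun h => Walk.isPath_of_length_eq_dist _ ?_⟩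
    have h1 := dist_le (Walk.cons h q)
    rw [G.dist_comm (u := u), G.dist_comm (u := u)] at hux
    simp at h1 ⊢
    omega
  obtain ⟨p, hp⟩ := key hz huz
  obtain ⟨q, hq⟩ := key hw huw
  have := (hG.isAcyclic.subsingleton_path v u).elim ⟨_, hp hz⟩ ⟨_, hq hw⟩
  simp at this
  exact this.1

theorem disjoint_branch (hG : G.IsTree) {v z w : V} (hz : G.Adj v z) (hw : G.Adj v w)
    (hzw : z ≠ w) : Disjoint (G.branch z v) (G.branch w v) :=
  Finset.disjoint_left.2 fun _ h1 h2 => hzw (hG.eq_of_mem_branch hz hw h1 h2)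

theorem disjoint_branch_symm {x y : V} : Disjoint (G.branch x y) (G.branch y x) :=
  Finset.disjoint_left.2 fun _ h1 h2 => by rw [mem_branch] at h1 h2; omega

theorem mem_branch_self {x y : V} (h : G.Adj x y) : x ∈ G.branch x y := by
  rw [mem_branch, dist_self, dist_eq_one_iff_adj.2 h]
  exact one_pos

theorem mem_branch_of_adj (hG : G.IsTree) {u w v z : V} (hz : G.Adj v z) (huw : G.Adj u w)
    (hw : w ≠ v) (hu : u ∈ G.branch z v) : w ∈ G.branch z v := by
  have step : ∀ {a b x : V}, G.Adj v x → G.Adj a b → G.dist v b = G.dist v a + 1 →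
      a ∈ G.branch x v → b ∈ G.branch x v := by
    intro a b x hx hab hd ha
    rw [mem_branch] at ha ⊢
    have := hG.connected.dist_triangle (u := b) (v := a) (w := x)
    rw [dist_eq_one_iff_adj.2 hab.symm] at this
    rw [G.dist_comm (u := b) (v := v), hd, G.dist_comm (u := v)]
    omega
  rcases hG.dist_eq_dist_add_one_of_adj v huw with h | h
  · obtain ⟨x, hx, hwx⟩ := hG.connected.exists_adj_mem_branch hw
    rwa [hG.eq_of_mem_branch hz hx hu (step hx huw.symm h hwx)]
  · exact step hz huw h hu

theorem subset_branch (hG : G.IsTree) {s : Finset V} {v z u : V} (hs : G.IsSubtree s)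
    (hv : v ∉ s) (hz : G.Adj v z) (hus : u ∈ s) (hu : u ∈ G.branch z v) : s ⊆ G.branch z v := by
  intro w hw
  obtain ⟨p⟩ := hs.2.preconnected ⟨u, hus⟩ ⟨w, hw⟩
  have key : ∀ (a b : (s : Set V)), (G.induce (s : Set V)).Walk a b → (a : V) ∈ G.branch z v →
      (b : V) ∈ G.branch z v := by
    intro a b p
    induction p with
    | nil => exact id
    | @cons a b _ hab _ ih =>
      intro ha
      refine ih (hG.mem_branch_of_adj hz hab ?_ ha)
      rintro rfl
      exact hv b.2
  exact key _ _ p hu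

theorem exists_subset_branch (hG : G.IsTree) {s : Finset V} {v : V} (hs : G.IsSubtree s)
    (hv : v ∉ s) : ∃ z, G.Adj v z ∧ s ⊆ G.branch z v := by
  obtain ⟨u, hu⟩ := hs.1
  obtain ⟨z, hz, huz⟩ := hG.connected.exists_adj_mem_branch (u := u) (v := v)
    (by rintro rfl; exact hv hu)
  exact ⟨z, hz, hG.subset_branch hs hv hz hu huz⟩

theorem branch_subset_branch (hG : G.IsTree) {x y z : V} (hy : G.Adj x y) (hz : G.Adj x z)
    (hzy : z ≠ y) : G.branch z x ⊆ G.branch x y := by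
  intro u hu
  have h1 : u ∉ G.branch y x := fun h => hzy (hG.eq_of_mem_branch hz hy hu h)
  have h2 := hG.dist_ne_of_adj u hy
  rw [mem_branch] at h1 ⊢
  omega

theorem card_branch_lt (hG : G.IsTree) {x y z : V} (hy : G.Adj x y) (hz : G.Adj x z)
    (hzy : z ≠ y) : (G.branch z x).card < (G.branch x y).card :=
  Finset.card_lt_card ⟨hG.branch_subset_branch hy hz hzy,
    fun h => notMem_branch_right z x (h (mem_branch_self hy))⟩

theorem prod_le_card_rootedIn (hG : G.IsTree) (v : V) (D : Finset V) (hD : ∀ z ∈ D, G.Adj v z) :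
    ∏ z ∈ D, (1 + (G.rootedIn z (G.branch z v)).card) ≤
      (G.rootedIn v (insert v (D.biUnion fun z => G.branch z v))).card := by
  induction D using Finset.induction_on with
  | empty =>
    rw [Finset.prod_empty]
    exact Finset.card_pos.2 ⟨{v}, mem_rootedIn.2 ⟨isSubtree_singleton v, by simp⟩⟩
  | insert a D ha ih =>
    have hva := hD a (Finset.mem_insert_self _ _)
    have hD' : ∀ z ∈ D, G.Adj v z := fun z hz => hD z (Finset.mem_insert_of_mem hz)
    have hempty : (∅ : Finset V) ∉ G.rootedIn a (G.branch a v) := fun h => by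
      simp [mem_rootedIn] at h
    rw [Finset.prod_insert ha, mul_comm, add_comm 1, ← Finset.card_insert_of_notMem hempty]
    refine (Nat.mul_le_mul_right _ (ih hD')).trans
      (card_mul_card_le_card_of_union (B := G.branch a v) ?_
        (fun s hs => (mem_rootedIn.1 hs).2.2) ?_ ?_)
    · rw [Finset.disjoint_insert_left, Finset.disjoint_biUnion_left]
      refine ⟨notMem_branch_right a v, fun z hz => hG.disjoint_branch (hD' z hz) hva ?_⟩
      rintro rfl
      exact ha hz
    · intro t ht
      rcases Finset.mem_insert.1 ht with rfl | ht
      · exact Finset.empty_subset _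
      · exact (mem_rootedIn.1 ht).2.2
    · intro s hs t ht
      obtain ⟨h1, h2, h3⟩ := mem_rootedIn.1 hs
      have h4 : s ⊆ insert v ((insert a D).biUnion fun z => G.branch z v) :=
        h3.trans (Finset.insert_subset_insert _
          (Finset.biUnion_subset_biUnion_of_subset_left _ (Finset.subset_insert _ _)))
      rcases Finset.mem_insert.1 ht with rfl | ht
      · rw [Finset.union_empty]
        exact mem_rootedIn.2 ⟨h1, h2, h4⟩
      · obtain ⟨t1, t2, t3⟩ := mem_rootedIn.1 ht
        refine mem_rootedIn.2 ⟨h1.union t1 h2 t2 hva, Finset.mem_union_left _ h2,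
          Finset.union_subset h4 (t3.trans ?_)⟩
        exact (Finset.subset_biUnion_of_mem (fun z => G.branch z v)
          (Finset.mem_insert_self a D)).trans (Finset.subset_insert _ _)

theorem branch_subset (hG : G.IsTree) (x y : V) :
    G.branch x y ⊆
      insert x (((G.neighborFinset x).erase y).biUnion fun z => G.branch z x) := by
  intro u hu
  rw [Finset.mem_insert, Finset.mem_biUnion]
  by_cases hux : u = x
  · exact Or.inl hux
  obtain ⟨z, hz, huz⟩ := hG.connected.exists_adj_mem_branch hux
  refine Or.inr ⟨z, Finset.mem_erase.2 ⟨?_, (G.mem_neighborFinset x z).2 hz⟩, huz⟩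
  rintro rfl
  exact Finset.disjoint_left.1 disjoint_branch_symm hu huz

theorem subset_branch_of_insert (hG : G.IsTree) {x y : V} (h : G.Adj x y) :
    insert x (((G.neighborFinset x).erase y).biUnion fun z => G.branch z x) ⊆
      G.branch x y := by
  refine Finset.insert_subset (mem_branch_self h) (Finset.biUnion_subset.2 fun z hz => ?_)
  obtain ⟨h1, h2⟩ := Finset.mem_erase.1 hz
  exact hG.branch_subset_branch h ((G.mem_neighborFinset x z).1 h2) h1

theorem card_subtreesIn_branch_le (hG : G.IsTree) {x y : V} (h : G.Adj x y) :
    (G.subtreesIn (G.branch x y)).card ≤ (G.rootedIn x (G.branch x y)).card +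
      ∑ z ∈ (G.neighborFinset x).erase y, (G.subtreesIn (G.branch z x)).card := by
  refine le_trans (Finset.card_le_card (t := G.rootedIn x (G.branch x y) ∪
    ((G.neighborFinset x).erase y).biUnion fun z => G.subtreesIn (G.branch z x)) ?_)
    ((Finset.card_union_le _ _).trans (Nat.add_le_add_left Finset.card_biUnion_le _))
  intro s hs
  obtain ⟨h1, h2⟩ := mem_subtreesIn.1 hs
  rw [Finset.mem_union, Finset.mem_biUnion]
  by_cases hx : x ∈ s
  · exact Or.inl (mem_rootedIn.2 ⟨h1, hx, h2⟩)
  obtain ⟨z, hz, hsz⟩ := hG.exists_subset_branch h1 hx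
  refine Or.inr ⟨z, Finset.mem_erase.2 ⟨?_, (G.mem_neighborFinset x z).2 hz⟩,
    mem_subtreesIn.2 ⟨h1, hsz⟩⟩
  rintro rfl
  obtain ⟨u, hu⟩ := h1.1
  exact Finset.disjoint_left.1 disjoint_branch_symm (h2 hu) (hsz hu)

theorem alphaBarV_le (hG : G.IsTree) (v : V) :
    alphaBarV G v ≤ ∑ z ∈ G.neighborFinset v, (G.subtreesIn (G.branch z v)).card := by
  refine le_trans (Finset.card_le_card (t := (G.neighborFinset v).biUnion
    fun z => G.subtreesIn (G.branch z v)) ?_) Finset.card_biUnion_le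
  intro s hs
  simp only [subtreeFinset, Finset.mem_filter, Finset.mem_univ, true_and] at hs
  obtain ⟨z, hz, hsz⟩ := hG.exists_subset_branch hs.1 hs.2
  exact Finset.mem_biUnion.2 ⟨z, (G.mem_neighborFinset v z).2 hz, mem_subtreesIn.2 ⟨hs.1, hsz⟩⟩

theorem prod_le_alphaV (hG : G.IsTree) (v : V) :
    ∏ z ∈ G.neighborFinset v, (1 + (G.rootedIn z (G.branch z v)).card) ≤ alphaV G v := by
  refine (hG.prod_le_card_rootedIn v _ fun z hz => (G.mem_neighborFinset v z).1 hz).trans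
    (Finset.card_le_card fun s hs => ?_)
  obtain ⟨h1, h2, -⟩ := mem_rootedIn.1 hs
  simp [subtreeFinset, h1, h2]

theorem alphaBarE_le (hG : G.IsTree) {x y : V} (h : G.Adj x y) :
    alphaBarE G x y ≤ (G.subtreesIn (G.branch x y)).card + (G.subtreesIn (G.branch y x)).card := by
  refine le_trans (Finset.card_le_card (t := G.subtreesIn (G.branch x y) ∪
    G.subtreesIn (G.branch y x)) ?_) (Finset.card_union_le _ _)
  have key : ∀ {x y : V} {s : Finset V}, G.Adj x y → G.IsSubtree s → y ∉ s →
      s ⊆ G.branch x y ∨ s ⊆ G.branch y x := by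
    intro x y s h hs hy
    obtain ⟨z, hz, hsz⟩ := hG.exists_subset_branch hs hy
    by_cases hzx : z = x
    · exact Or.inl (hzx ▸ hsz)
    · exact Or.inr (hsz.trans (hG.branch_subset_branch h.symm hz hzx))
  intro s hs
  simp only [subtreeFinset, Finset.mem_filter, Finset.mem_univ, true_and] at hs
  rw [Finset.mem_union, mem_subtreesIn, mem_subtreesIn]
  by_cases hx : x ∈ s
  · rcases key h hs.1 (fun hy => hs.2 ⟨hx, hy⟩) with h' | h'
    exacts [Or.inl ⟨hs.1, h'⟩, Or.inr ⟨hs.1, h'⟩]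
  · rcases key h.symm hs.1 hx with h' | h'
    exacts [Or.inr ⟨hs.1, h'⟩, Or.inl ⟨hs.1, h'⟩]

theorem mul_le_alphaE {x y : V} (h : G.Adj x y) :
    (G.rootedIn x (G.branch x y)).card * (G.rootedIn y (G.branch y x)).card ≤ alphaE G x y := by
  refine card_mul_card_le_card_of_union disjoint_branch_symm
    (fun s hs => (mem_rootedIn.1 hs).2.2) (fun s hs => (mem_rootedIn.1 hs).2.2) ?_
  intro s hs t ht
  obtain ⟨s1, s2, -⟩ := mem_rootedIn.1 hs
  obtain ⟨t1, t2, -⟩ := mem_rootedIn.1 ht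
  simp [subtreeFinset, s1.union t1 s2 t2 h, s2, t2]

end IsTree

theorem branch_bounds (hG : InT3 G) {x y : V} (h : G.Adj x y) :
    1 ≤ (G.rootedIn x (G.branch x y)).card ∧
    (G.subtreesIn (G.branch x y)).card + 1 ≤ 2 * (G.rootedIn x (G.branch x y)).card ∧
    2 ^ ((G.branch x y).card + 1) ≤ (1 + (G.rootedIn x (G.branch x y)).card) ^ 2 := by
  obtain ⟨hT, -, hdeg⟩ := hG
  induction hc : (G.branch x y).card using Nat.strong_induction_on generalizing x y with
  | _ c ih =>
  subst hc
  set D := (G.neighborFinset x).erase y with hD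
  have hDadj : ∀ z ∈ D, G.Adj x z ∧ z ≠ y := fun z hz =>
    ⟨(G.mem_neighborFinset x z).1 (Finset.mem_of_mem_erase hz), Finset.ne_of_mem_erase hz⟩
  have hDcard : D.card + 1 = G.degree x :=
    Finset.card_erase_add_one ((G.mem_neighborFinset x y).2 h)
  have IH : ∀ z ∈ D, _ := fun z hz =>
    ih _ (hT.card_branch_lt h (hDadj z hz).1 (hDadj z hz).2) (hDadj z hz).1.symm rfl
  have hprod : ∏ z ∈ D, (1 + (G.rootedIn z (G.branch z x)).card) ≤
      (G.rootedIn x (G.branch x y)).card := by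
    refine (hT.prod_le_card_rootedIn x D fun z hz => (hDadj z hz).1).trans
      (Finset.card_le_card fun s hs => ?_)
    obtain ⟨h1, h2, h3⟩ := mem_rootedIn.1 hs
    exact mem_rootedIn.2 ⟨h1, h2, h3.trans (hT.subset_branch_of_insert h)⟩
  have hsum := hT.card_subtreesIn_branch_le h
  rw [← hD] at hsum
  have hcard : (G.branch x y).card ≤ ∑ z ∈ D, (G.branch z x).card + 1 :=
    (Finset.card_le_card (hT.branch_subset x y)).trans
      ((Finset.card_insert_le _ _).trans (Nat.add_le_add_right Finset.card_biUnion_le _))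
  have hone : 1 ≤ (G.rootedIn x (G.branch x y)).card :=
    (Nat.one_le_iff_ne_zero.2 (Finset.prod_ne_zero_iff.2 fun z _ => by omega)).trans hprod
  refine ⟨hone, ?_⟩
  rcases Finset.eq_empty_or_nonempty D with hempty | hne
  · rw [hempty, Finset.sum_empty] at hsum hcard
    refine ⟨by omega, ?_⟩
    calc 2 ^ ((G.branch x y).card + 1) ≤ 2 ^ 2 := Nat.pow_le_pow_right two_pos (by omega)
      _ ≤ _ := Nat.pow_le_pow_left (by omega) 2
  · have hD1 := hne.card_pos
    have hD2 : 2 ≤ D.card := by have := hdeg x (by omega); omega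
    constructor
    · have h1 := two_mul_sum_lt_prod_add_card D _ (fun z hz => (IH z hz).1) hD2
      have h2 : ∑ z ∈ D, (G.subtreesIn (G.branch z x)).card + D.card ≤
          2 * ∑ z ∈ D, (G.rootedIn z (G.branch z x)).card := by
        rw [Finset.card_eq_sum_ones, ← Finset.sum_add_distrib, Finset.mul_sum]
        exact Finset.sum_le_sum fun z hz => (IH z hz).2.1
      omega
    · have h1 := two_pow_le_prod_sq le_rfl fun z hz => (IH z hz).2.2
      calc 2 ^ ((G.branch x y).card + 1)
          ≤ 2 ^ (∑ z ∈ D, (G.branch z x).card + D.card) :=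
            Nat.pow_le_pow_right two_pos (by omega)
        _ ≤ _ := h1.trans (Nat.pow_le_pow_left (hprod.trans (Nat.le_add_left _ _)) 2)

/-- Orienting every edge towards its large side, some vertex has only small branches. -/
theorem exists_forall_branch_not {P : V → V → Prop} (hT : G.IsTree)
    (h : ∀ x y, G.Adj x y → ¬ (P x y ∧ P y x)) : ∃ v, ∀ z, G.Adj v z → ¬ P z v := by
  by_contra! hcon
  have key : ∀ c (z v : V), (G.branch z v).card = c → G.Adj v z → ¬ P z v := by
    intro c
    induction c using Nat.strong_induction_on with
    | _ c ih =>
    intro z v hc hz hP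
    obtain ⟨w, hw, hPw⟩ := hcon z
    by_cases hwv : w = v
    · subst hwv
      exact h _ _ hz ⟨hPw, hP⟩
    · exact ih _ (hc ▸ hT.card_branch_lt hz.symm hw hwv) w z rfl hw hPw
  obtain ⟨v⟩ := hT.connected.nonempty
  obtain ⟨z, hz, hP⟩ := hcon v
  exact key _ z v rfl hz hP

end SimpleGraph

/-- If `T ∈ 𝒯₃` has `n ≥ 30` vertices then there is an edge `e` with
`2·α(T,e) ≥ n·ᾱ(T,e)`, or an internal vertex `v` with `2·α(T,v) ≥ n·ᾱ(T,v)`. -/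
theorem exists_edge_or_internal_vertex {V : Type*} [Fintype V] (G : SimpleGraph V)
    (h : InT3 G) (hn : 30 ≤ Fintype.card V) :
    (∃ x y, G.Adj x y ∧ Fintype.card V * alphaBarE G x y ≤ 2 * alphaE G x y) ∨
      ∃ v, 2 ≤ G.degree v ∧ Fintype.card V * alphaBarV G v ≤ 2 * alphaV G v := by
  have hT := h.1
  by_contra hcon
  rw [not_or] at hcon
  obtain ⟨hE, hV⟩ := hcon
  push Not at hE hV
  set n := Fintype.card V with hn'
  obtain ⟨v, hv⟩ := exists_forall_branch_not
    (P := fun x y => 2 * n ≤ (G.rootedIn x (G.branch x y)).card) hT (by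
      rintro x y hxy ⟨hx, hy⟩
      have h1 := hE x y hxy
      have h2 := hT.alphaBarE_le hxy
      have h3 := IsTree.mul_le_alphaE hxy
      have h4 := (branch_bounds h hxy).2.1
      have h5 := (branch_bounds h hxy.symm).2.1
      have h6 : alphaBarE G x y ≤ 2 * ((G.rootedIn x (G.branch x y)).card +
        (G.rootedIn y (G.branch y x)).card) := by omega
      have h7 := Nat.mul_le_mul_left n h6
      nlinarith [Nat.mul_le_mul_right (G.rootedIn y (G.branch y x)).card hx,
        Nat.mul_le_mul_left (G.rootedIn x (G.branch x y)).card hy])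
  have hadj : ∀ z ∈ G.neighborFinset v, G.Adj v z := fun z hz => (G.mem_neighborFinset v z).1 hz
  have hsmall : ∀ z ∈ G.neighborFinset v, 1 + (G.rootedIn z (G.branch z v)).card ≤ 2 * n :=
    fun z hz => by have := hv z (hadj z hz); omega
  have hcard : n - 1 ≤ ∑ z ∈ G.neighborFinset v, (G.branch z v).card := by
    have hsub : (Finset.univ : Finset V) ⊆
        insert v ((G.neighborFinset v).biUnion fun z => G.branch z v) := by
      intro u _
      rw [Finset.mem_insert, Finset.mem_biUnion]
      by_cases huv : u = v
      · exact Or.inl huv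
      obtain ⟨z, hz, huz⟩ := hT.connected.exists_adj_mem_branch huv
      exact Or.inr ⟨z, (G.mem_neighborFinset v z).2 hz, huz⟩
    have := (Finset.card_le_card hsub).trans
      ((Finset.card_insert_le _ _).trans (Nat.add_le_add_right Finset.card_biUnion_le _))
    rw [Finset.card_univ] at this
    omega
  have hsq := two_pow_le_prod_sq hcard
    fun z hz => (branch_bounds h (hadj z hz).symm).2.2
  have hpow := pow_six_le_two_pow hn
  rw [card_neighborFinset_eq_degree] at hsq
  have hdeg : 2 ≤ G.degree v := by
    by_contra hlt
    have hprod : ∏ z ∈ G.neighborFinset v, (1 + (G.rootedIn z (G.branch z v)).card) ≤ 2 * n := by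
      refine (Finset.prod_le_pow_card _ _ _ hsmall).trans ?_
      rw [card_neighborFinset_eq_degree]
      exact (Nat.pow_le_pow_right (by omega) (show G.degree v ≤ 1 by omega)).trans (pow_one _).le
    have : Nontrivial V := Fintype.one_lt_card_iff_nontrivial.1 (by omega)
    have hpos := hT.connected.preconnected.degree_pos_of_nontrivial v
    have h1 : n ^ 6 ≤ (2 * n) ^ 2 := hpow.trans ((Nat.pow_le_pow_right two_pos (by omega)).trans
      (hsq.trans (Nat.pow_le_pow_left hprod 2)))
    have h2 : n ^ 6 = n ^ 2 * n ^ 4 := by ring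
    have h3 : 5 ≤ n ^ 4 := (show 5 ≤ 30 ^ 4 by norm_num).trans (Nat.pow_le_pow_left hn 4)
    have h4 : 0 < n ^ 2 := by positivity
    nlinarith
  have hdeg3 := h.2.2 v hdeg
  have hlarge : 2 * n ^ 3 ≤ alphaV G v := by
    refine le_trans ?_ (hT.prod_le_alphaV v)
    refine (Nat.pow_le_pow_iff_left two_ne_zero).1 (le_trans ?_ hsq)
    calc (2 * n ^ 3) ^ 2 = 2 ^ 2 * n ^ 6 := by ring
      _ ≤ 2 ^ 2 * 2 ^ n := Nat.mul_le_mul_left _ hpow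
      _ = 2 ^ (2 + n) := (pow_add _ _ _).symm
      _ ≤ _ := Nat.pow_le_pow_right two_pos (by omega)
  have hbar : alphaBarV G v ≤ n * (4 * n) := by
    refine (hT.alphaBarV_le v).trans ((Finset.sum_le_card_nsmul _ _ (4 * n) ?_).trans ?_)
    · intro z hz
      have h1 := (branch_bounds h (hadj z hz).symm).2.1
      have h2 := hsmall z hz
      omega
    · exact Nat.mul_le_mul_right _ (Finset.card_le_univ _)
  have h1 := hV v hdeg
  have h2 := Nat.mul_le_mul_left n hbar
  have h3 : n * (n * (4 * n)) = 4 * n ^ 3 := by ring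
  omega
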